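/- Let C be the free graded Z-module with generators a0 in degree 1, c'_i in degree c + i - 1 and d'_i in degree -(c + i - 1) for 1 ≤ i ≤ k (for some integer c), with differential d(c'_i) = -ε1_i · c'_{i-1} and d(d'_i) = ±ε2_i · d'_{i+1} and d(a0) = 0, where for each i exactly one of the pattern holds: d(c'_{2j}) = -c'_{2j-1}, d(c'_{2j+1}) = 0, d(d'_{2j}) = ±d'_{2j+1}, d(d'_{2j+1}) = 0 (terms with index outside 1..k set to 0). Then the homology of C is free of rank 3: generated by [a0] in degree 1, by [c'_k] if k is odd or [d'_k] if k is even, and by [d'_1]. -/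

import Mathlib

/-- The degree-`j` homology of a differential `D` restricted to a submodule
`P`, i.e. `(ker D ∩ P) / (im D ∩ P)`; with `P = ⊤` this is the total homology
`ker D / im D`. -/
def homologyAt {R V : Type*} [Ring R] [AddCommGroup V] [Module R V]
    (D : V →ₗ[R] V) (P : Submodule R V) : Type _ :=
  ↥(LinearMap.ker D ⊓ P) ⧸
    Submodule.comap (LinearMap.ker D ⊓ P).subtype (LinearMap.range D ⊓ P)

noncomputable instance {R V : Type*} [Ring R] [AddCommGroup V] [Module R V]
    (D : V →ₗ[R] V) (P : Submodule R V) : AddCommGroup (homologyAt D P) :=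
  Submodule.Quotient.addCommGroup _

noncomputable instance {R V : Type*} [Ring R] [AddCommGroup V] [Module R V]
    (D : V →ₗ[R] V) (P : Submodule R V) : Module R (homologyAt D P) :=
  Submodule.Quotient.module _

/-- The homology class of a cycle. -/
def homologyMk {R V : Type*} [Ring R] [AddCommGroup V] [Module R V]
    (D : V →ₗ[R] V) (P : Submodule R V) (x : ↥(LinearMap.ker D ⊓ P)) :
    homologyAt D P :=
  Submodule.Quotient.mk x

/-- Generators of the complex of an unknot interlaced with `k` parallel
strands: `Sum.inl ()` is the right cusp `a0` of the unknot, `Sum.inr (Sum.inl i)`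
is `c'_{i+1}` and `Sum.inr (Sum.inr i)` is `d'_{i+1}`. -/
def Gen15 (k : ℕ) : Type := Unit ⊕ (Fin k ⊕ Fin k)

instance (k : ℕ) : DecidableEq (Gen15 k) := by unfold Gen15; infer_instance
instance (k : ℕ) : Fintype (Gen15 k) := by unfold Gen15; infer_instance

/-- Basis vector of `c'_i` (`1`-based index), or `0` if `i ∉ {1, …, k}`. -/
def cvec (k : ℕ) (i : ℤ) : Gen15 k → ℤ :=
  if h : 1 ≤ i ∧ i ≤ k then
    Pi.single (Sum.inr (Sum.inl ⟨(i - 1).toNat, by omega⟩)) 1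
  else 0

/-- Basis vector of `d'_i` (`1`-based index), or `0` if `i ∉ {1, …, k}`. -/
def dvec (k : ℕ) (i : ℤ) : Gen15 k → ℤ :=
  if h : 1 ≤ i ∧ i ≤ k then
    Pi.single (Sum.inr (Sum.inr ⟨(i - 1).toNat, by omega⟩)) 1
  else 0

/-- Degrees: `|a0| = 1`, `|c'_i| = c + i - 1`, `|d'_i| = -(c + i - 1)`. -/
def deg15 (k : ℕ) (c : ℤ) : Gen15 k → ℤ := fun g =>
  match g with
  | Sum.inl _ => 1
  | Sum.inr (Sum.inl i) => c + ((i.val : ℤ) + 1) - 1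
  | Sum.inr (Sum.inr i) => -(c + ((i.val : ℤ) + 1) - 1)

/-- The differential: `d a0 = 0`, `d c'_{2j} = -c'_{2j-1}`, `d c'_{2j+1} = 0`,
`d d'_{2j} = (-1)^{|d'_{2j+1}|} d'_{2j+1}`, `d d'_{2j+1} = 0`, where terms with
index outside `{1, …, k}` are `0`. -/
noncomputable def D15 (k : ℕ) (c : ℤ) : (Gen15 k → ℤ) →ₗ[ℤ] (Gen15 k → ℤ) :=
  (Pi.basisFun ℤ (Gen15 k)).constr ℤ fun g =>
    match g with
    | Sum.inl _ => 0
    | Sum.inr (Sum.inl i) =>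
        let m : ℤ := (i.val : ℤ) + 1
        if m % 2 = 0 then -cvec k (m - 1) else 0
    | Sum.inr (Sum.inr i) =>
        let m : ℤ := (i.val : ℤ) + 1
        if m % 2 = 0 then
          ((((-1 : ℤˣ) ^ (-(c + (m + 1) - 1)) : ℤˣ) : ℤ)) • dvec k (m + 1)
        else 0

/-- The generator `a0`. -/
def genA (k : ℕ) : Gen15 k := Sum.inl ()

/-- The generator `c'_{i+1}`. -/
def genC {k : ℕ} (i : Fin k) : Gen15 k := Sum.inr (Sum.inl i)

/-- The generator `d'_{i+1}`. -/
def genD {k : ℕ} (i : Fin k) : Gen15 k := Sum.inr (Sum.inr i)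

theorem Gen15.forall_iff {k : ℕ} {p : Gen15 k → Prop} :
    (∀ g, p g) ↔ p (genA k) ∧ (∀ i, p (genC i)) ∧ ∀ i, p (genD i) := by
  refine ⟨fun h => ⟨h _, fun i => h _, fun i => h _⟩, ?_⟩
  rintro ⟨hA, hC, hD⟩ (_ | i | i)
  exacts [hA, hC i, hD i]

@[simp] theorem genC_inj {k : ℕ} (i j : Fin k) : genC i = genC j ↔ i = j :=
  ⟨fun h => Sum.inl_injective (Sum.inr_injective h), fun h => h ▸ rfl⟩

@[simp] theorem genD_inj {k : ℕ} (i j : Fin k) : genD i = genD j ↔ i = j :=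
  ⟨fun h => Sum.inr_injective (Sum.inr_injective h), fun h => h ▸ rfl⟩

@[simp] theorem genA_ne_genC {k : ℕ} (i : Fin k) : genA k ≠ genC i := Sum.inl_ne_inr

@[simp] theorem genA_ne_genD {k : ℕ} (i : Fin k) : genA k ≠ genD i := Sum.inl_ne_inr

@[simp] theorem genC_ne_genA {k : ℕ} (i : Fin k) : genC i ≠ genA k := Sum.inr_ne_inl

@[simp] theorem genD_ne_genA {k : ℕ} (i : Fin k) : genD i ≠ genA k := Sum.inr_ne_inl

@[simp] theorem genC_ne_genD {k : ℕ} (i j : Fin k) : genC i ≠ genD j :=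
  fun h => Sum.inl_ne_inr (Sum.inr_injective h)

@[simp] theorem genD_ne_genC {k : ℕ} (i j : Fin k) : genD i ≠ genC j :=
  fun h => Sum.inr_ne_inl (Sum.inr_injective h)

@[simp] theorem cvec_genA (k : ℕ) (m : ℤ) : cvec k m (genA k) = 0 := by
  unfold cvec
  split_ifs
  · exact Pi.single_eq_of_ne (genA_ne_genC _) _
  · rfl

@[simp] theorem cvec_genD {k : ℕ} (m : ℤ) (i : Fin k) : cvec k m (genD i) = 0 := by
  unfold cvec
  split_ifs
  · exact Pi.single_eq_of_ne (genD_ne_genC _ _) _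
  · rfl

@[simp] theorem cvec_genC {k : ℕ} (m : ℤ) (i : Fin k) :
    cvec k m (genC i) = if m = i + 1 then 1 else 0 := by
  unfold cvec
  split_ifs with h₁ h₂ h₂
  · have : (⟨(m - 1).toNat, by omega⟩ : Fin k) = i := Fin.ext (by simp; omega)
    rw [this]
    exact Pi.single_eq_same (genC i) _
  · refine Pi.single_eq_of_ne (fun h => h₂ ?_) _
    have := congrArg Fin.val ((genC_inj _ _).1 h)
    simp at this
    omega
  · omega
  · rfl

@[simp] theorem dvec_genA (k : ℕ) (m : ℤ) : dvec k m (genA k) = 0 := by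
  unfold dvec
  split_ifs
  · exact Pi.single_eq_of_ne (genA_ne_genD _) _
  · rfl

@[simp] theorem dvec_genC {k : ℕ} (m : ℤ) (i : Fin k) : dvec k m (genC i) = 0 := by
  unfold dvec
  split_ifs
  · exact Pi.single_eq_of_ne (genC_ne_genD _ _) _
  · rfl

@[simp] theorem dvec_genD {k : ℕ} (m : ℤ) (i : Fin k) :
    dvec k m (genD i) = if m = i + 1 then 1 else 0 := by
  unfold dvec
  split_ifs with h₁ h₂ h₂
  · have : (⟨(m - 1).toNat, by omega⟩ : Fin k) = i := Fin.ext (by simp; omega)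
    rw [this]
    exact Pi.single_eq_same (genD i) _
  · refine Pi.single_eq_of_ne (fun h => h₂ ?_) _
    have := congrArg Fin.val ((genD_inj _ _).1 h)
    simp at this
    omega
  · omega
  · rfl

/-- The coefficient of `c'_{n+1}`, or `0` if there is no such generator. -/
def coeffC {k : ℕ} (n : ℕ) : (Gen15 k → ℤ) →ₗ[ℤ] ℤ :=
  if h : n < k then LinearMap.proj (genC ⟨n, h⟩) else 0

/-- The coefficient of `d'_{n+1}`, or `0` if there is no such generator. -/
def coeffD {k : ℕ} (n : ℕ) : (Gen15 k → ℤ) →ₗ[ℤ] ℤ :=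
  if h : n < k then LinearMap.proj (genD ⟨n, h⟩) else 0

theorem coeffC_apply {k : ℕ} (n : ℕ) (x : Gen15 k → ℤ) :
    coeffC n x = if h : n < k then x (genC ⟨n, h⟩) else 0 := by
  unfold coeffC; split_ifs <;> rfl

theorem coeffD_apply {k : ℕ} (n : ℕ) (x : Gen15 k → ℤ) :
    coeffD n x = if h : n < k then x (genD ⟨n, h⟩) else 0 := by
  unfold coeffD; split_ifs <;> rfl

/-- The sign `(-1)^{|d'_{n+1}|}`. -/
def signD (c : ℤ) (n : ℕ) : ℤˣ := (-1) ^ (-(c + ((n : ℤ) + 1) - 1))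

theorem signD_mul_self (c : ℤ) (n : ℕ) : (signD c n : ℤ) * signD c n = 1 := by
  rcases Int.units_eq_one_or (signD c n) with h | h <;> simp [h]

section Differential

variable {k : ℕ} (c : ℤ)

theorem D15_single_genA : D15 k c (Pi.single (genA k) 1) = 0 := by
  rw [← Pi.basisFun_apply ℤ]
  exact (Pi.basisFun ℤ (Gen15 k)).constr_basis ℤ _ _

theorem D15_single_genC (i : Fin k) :
    D15 k c (Pi.single (genC i) 1) =
      if ((i : ℤ) + 1) % 2 = 0 then -cvec k ((i : ℤ) + 1 - 1) else 0 := by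
  rw [← Pi.basisFun_apply ℤ]
  exact (Pi.basisFun ℤ (Gen15 k)).constr_basis ℤ _ _

theorem D15_single_genD (i : Fin k) :
    D15 k c (Pi.single (genD i) 1) =
      if ((i : ℤ) + 1) % 2 = 0 then (signD c (i + 1) : ℤ) • dvec k ((i : ℤ) + 1 + 1)
      else 0 := by
  rw [← Pi.basisFun_apply ℤ]
  exact (Pi.basisFun ℤ (Gen15 k)).constr_basis ℤ _ _

theorem D15_genA (x : Gen15 k → ℤ) : D15 k c x (genA k) = 0 := by
  suffices LinearMap.proj (genA k) ∘ₗ D15 k c = 0 from LinearMap.congr_fun this x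
  refine (Pi.basisFun ℤ (Gen15 k)).ext (Gen15.forall_iff.2 ⟨?_, fun i => ?_, fun i => ?_⟩)
  · simp [D15_single_genA]
  · simp only [Pi.basisFun_apply, LinearMap.comp_apply, D15_single_genC]
    split_ifs <;> simp
  · simp only [Pi.basisFun_apply, LinearMap.comp_apply, D15_single_genD]
    split_ifs <;> simp

theorem D15_genC (x : Gen15 k → ℤ) (j : Fin k) :
    D15 k c x (genC j) = if (j : ℕ) % 2 = 0 then -coeffC (j + 1) x else 0 := by
  suffices LinearMap.proj (genC j) ∘ₗ D15 k c =
      if (j : ℕ) % 2 = 0 then -coeffC (j + 1) else 0 by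
    refine (LinearMap.congr_fun this x).trans ?_
    split_ifs <;> rfl
  refine (Pi.basisFun ℤ (Gen15 k)).ext (Gen15.forall_iff.2 ⟨?_, fun i => ?_, fun i => ?_⟩)
  · simp only [Pi.basisFun_apply, LinearMap.comp_apply, D15_single_genA]
    split_ifs <;> simp [coeffC_apply]
  · simp only [Pi.basisFun_apply, LinearMap.comp_apply, D15_single_genC]
    split_ifs <;> simp [coeffC_apply, Pi.single_apply, Fin.ext_iff] <;> grind
  · simp only [Pi.basisFun_apply, LinearMap.comp_apply, D15_single_genD]
    split_ifs <;> simp [coeffC_apply]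

theorem D15_genD (x : Gen15 k → ℤ) (j : Fin k) :
    D15 k c x (genD j) =
      if (j : ℕ) % 2 = 0 ∧ 0 < (j : ℕ) then signD c j * coeffD (j - 1) x else 0 := by
  suffices LinearMap.proj (genD j) ∘ₗ D15 k c =
      if (j : ℕ) % 2 = 0 ∧ 0 < (j : ℕ) then (signD c j : ℤ) • coeffD (j - 1) else 0 by
    refine (LinearMap.congr_fun this x).trans ?_
    split_ifs <;> rfl
  refine (Pi.basisFun ℤ (Gen15 k)).ext (Gen15.forall_iff.2 ⟨?_, fun i => ?_, fun i => ?_⟩)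
  · simp only [Pi.basisFun_apply, LinearMap.comp_apply, D15_single_genA]
    split_ifs <;> simp [coeffD_apply]
  · simp only [Pi.basisFun_apply, LinearMap.comp_apply, D15_single_genC]
    split_ifs <;> simp [coeffD_apply]
  · simp only [Pi.basisFun_apply, LinearMap.comp_apply, D15_single_genD]
    split_ifs <;> simp [coeffD_apply, Pi.single_apply, Fin.ext_iff] <;> grind

end Differential

/-- The coefficient of the top generator `c'_k` (`k` odd) or `d'_k` (`k` even). -/
def coeffTop (k : ℕ) : (Gen15 k → ℤ) →ₗ[ℤ] ℤ :=
  if Odd k then coeffC (k - 1) else coeffD (k - 1)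

/-- The coefficients of the three generators surviving to homology. -/
def survivors (k : ℕ) : (Gen15 k → ℤ) →ₗ[ℤ] (Fin 3 → ℤ) :=
  LinearMap.pi ![LinearMap.proj (genA k), coeffTop k, coeffD 0]

theorem survivors_eq_zero_iff {k : ℕ} {x : Gen15 k → ℤ} :
    survivors k x = 0 ↔ x (genA k) = 0 ∧ coeffTop k x = 0 ∧ coeffD 0 x = 0 := by
  simp [survivors, funext_iff, Fin.forall_fin_succ]

theorem survivors_D15 {k : ℕ} (c : ℤ) (y : Gen15 k → ℤ) : survivors k (D15 k c y) = 0 := by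
  refine survivors_eq_zero_iff.2 ⟨D15_genA c y, ?_, ?_⟩
  · unfold coeffTop
    split_ifs with h
    · simp only [coeffC_apply, D15_genC]
      grind
    · simp only [coeffD_apply, D15_genD]
      grind
  · simp [coeffD_apply, D15_genD]

theorem mem_range_D15 {k : ℕ} {c : ℤ} {x : Gen15 k → ℤ} (hx : D15 k c x = 0)
    (hs : survivors k x = 0) : x ∈ LinearMap.range (D15 k c) := by
  obtain ⟨hA, hT, h0⟩ := survivors_eq_zero_iff.1 hs
  have hC : ∀ n, n % 2 = 1 → coeffC n x = 0 := fun n hn => by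
    by_cases h : n < k
    · have := congrFun hx (genC ⟨n - 1, by omega⟩)
      rw [D15_genC] at this
      simpa [show (n - 1) % 2 = 0 by omega, show n - 1 + 1 = n by omega] using this
    · simp [coeffC_apply, h]
  have hD : ∀ n, n % 2 = 1 → n + 1 < k → coeffD n x = 0 := fun n hn h => by
    have := congrFun hx (genD ⟨n + 1, h⟩)
    rw [D15_genD] at this
    simpa [show (n + 1) % 2 = 0 by omega] using this
  refine ⟨fun g => match g with
    | Sum.inl _ => 0
    | Sum.inr (Sum.inl i) => if (i : ℕ) % 2 = 1 then -coeffC (i - 1) x else 0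
    | Sum.inr (Sum.inr i) =>
        if (i : ℕ) % 2 = 1 then signD c (i + 1) * coeffD (i + 1) x else 0, ?_⟩
  refine funext (Gen15.forall_iff.2 ⟨?_, fun i => ?_, fun i => ?_⟩)
  · rw [D15_genA, hA]
  · have hi : x (genC i) = coeffC i x := by simp [coeffC_apply]
    have hT' : Odd k → coeffC (k - 1) x = 0 := fun h => by simpa [coeffTop, h] using hT
    rw [D15_genC, coeffC_apply, hi]
    simp only [genC]
    split_ifs with h₁ h₂ h₃
    · simp
    · omega
    · rw [show (i : ℕ) = k - 1 by omega, hT' (by rw [Nat.odd_iff]; omega), neg_zero]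
    · exact (hC _ (by omega)).symm
  · have hi : x (genD i) = coeffD i x := by simp [coeffD_apply]
    have hT' : ¬ Odd k → coeffD (k - 1) x = 0 := fun h => by simpa [coeffTop, h] using hT
    rw [D15_genD, coeffD_apply, hi]
    simp only [genD]
    split_ifs with h₁ h₂ h₃
    · rw [Nat.sub_add_cancel h₁.2, ← mul_assoc, signD_mul_self, one_mul]
    · omega
    · omega
    · by_cases h : (i : ℕ) = 0
      · rw [h, h0]
      · by_cases h' : (i : ℕ) + 1 < k
        · exact (hD _ (by omega) h').symm
        · rw [show (i : ℕ) = k - 1 by omega, hT' (by rw [Nat.odd_iff]; omega)]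

/-- The class of a cycle is determined by the coefficients of the surviving generators. -/
theorem homologyMk_eq_of_survivors_eq {k : ℕ} {c : ℤ}
    {x y : ↥(LinearMap.ker (D15 k c) ⊓ (⊤ : Submodule ℤ (Gen15 k → ℤ)))}
    (h : survivors k x = survivors k y) :
    homologyMk (D15 k c) ⊤ x = homologyMk (D15 k c) ⊤ y := by
  refine (Submodule.Quotient.eq _).2 ⟨mem_range_D15 (c := c) ?_ ?_, trivial⟩
  · exact (x - y).2.1
  · simp [h]

/-- The coefficients of the surviving generators, as a map on homology. -/
noncomputable def homologySurvivors (k : ℕ) (c : ℤ) :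
    homologyAt (D15 k c) (⊤ : Submodule ℤ (Gen15 k → ℤ)) →ₗ[ℤ] (Fin 3 → ℤ) :=
  Submodule.liftQ _ (survivors k ∘ₗ Submodule.subtype _) <| by
    rintro x ⟨⟨y, hy⟩, -⟩
    have hy' : D15 k c y = x := hy
    simp [← hy', survivors_D15]

theorem homologySurvivors_mk {k : ℕ} {c : ℤ}
    (x : ↥(LinearMap.ker (D15 k c) ⊓ (⊤ : Submodule ℤ (Gen15 k → ℤ)))) :
    homologySurvivors k c (homologyMk (D15 k c) ⊤ x) = survivors k x :=
  rfl

theorem homologySurvivors_injective (k : ℕ) (c : ℤ) :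
    Function.Injective (homologySurvivors k c) := by
  intro a b hab
  obtain ⟨x, rfl⟩ := Submodule.Quotient.mk_surjective _ a
  obtain ⟨y, rfl⟩ := Submodule.Quotient.mk_surjective _ b
  exact homologyMk_eq_of_survivors_eq hab

theorem survivors_a0 (k : ℕ) : survivors k (Pi.single (genA k) 1) = Pi.single 0 1 := by
  ext i
  fin_cases i
  · simp [survivors]
  · simp only [survivors, coeffTop]
    split_ifs <;> simp [coeffC_apply, coeffD_apply]
  · simp [survivors, coeffD_apply]

theorem survivors_top {k : ℕ} (hk : 0 < k) :
    survivors k (if Odd k then cvec k k else dvec k k) = Pi.single 1 1 := by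
  ext i
  fin_cases i
  · split_ifs <;> simp [survivors]
  · simp only [survivors, coeffTop]
    split_ifs <;> simp [coeffC_apply, coeffD_apply] <;> grind
  · split_ifs with h
    · simp [survivors, coeffD_apply]
    · simp [survivors, coeffD_apply]
      grind

theorem survivors_d1 {k : ℕ} (hk : 0 < k) : survivors k (dvec k 1) = Pi.single 2 1 := by
  ext i
  fin_cases i
  · simp [survivors]
  · simp only [survivors, coeffTop]
    split_ifs <;> simp [coeffC_apply, coeffD_apply]
    grind
  · simp [survivors, coeffD_apply, hk]

theorem D15_top (k : ℕ) (c : ℤ) : D15 k c (if Odd k then cvec k k else dvec k k) = 0 := by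
  refine funext (Gen15.forall_iff.2 ⟨D15_genA c _, fun i => ?_, fun i => ?_⟩)
  · rw [D15_genC, coeffC_apply]
    split_ifs <;> simp
    grind
  · rw [D15_genD, coeffD_apply]
    split_ifs <;> simp
    grind

theorem D15_d1 (k : ℕ) (c : ℤ) : D15 k c (dvec k 1) = 0 := by
  refine funext (Gen15.forall_iff.2 ⟨D15_genA c _, fun i => ?_, fun i => ?_⟩)
  · rw [D15_genC, coeffC_apply]
    split_ifs <;> simp
  · rw [D15_genD, coeffD_apply]
    split_ifs <;> simp
    grind

/-- For the unknot interlaced with `k ≥ 1` parallel strands (Section 4.3), the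
homology is free of rank `3`, generated by the class of `a0` (in degree `1`),
the class of `c'_k` if `k` is odd or of `d'_k` if `k` is even, and the class
of `d'_1`. -/
theorem stmt_15 (k : ℕ) (hk : 0 < k) (c : ℤ) :
    ∃ h1 h2 h3 : ↥(LinearMap.ker (D15 k c) ⊓ (⊤ : Submodule ℤ (Gen15 k → ℤ))),
      (h1 : Gen15 k → ℤ) = Pi.single (Sum.inl ()) 1 ∧
      (h2 : Gen15 k → ℤ) = (if Odd k then cvec k k else dvec k k) ∧
      (h3 : Gen15 k → ℤ) = dvec k 1 ∧
      Submodule.span ℤ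
        {homologyMk (D15 k c) ⊤ h1, homologyMk (D15 k c) ⊤ h2,
         homologyMk (D15 k c) ⊤ h3} = ⊤ ∧
      Nonempty (homologyAt (D15 k c) (⊤ : Submodule ℤ (Gen15 k → ℤ)) ≃ₗ[ℤ]
        (Fin 3 → ℤ)) := by
  let h1 : ↥(LinearMap.ker (D15 k c) ⊓ (⊤ : Submodule ℤ (Gen15 k → ℤ))) :=
    ⟨Pi.single (genA k) 1, D15_single_genA c, trivial⟩
  let h2 : ↥(LinearMap.ker (D15 k c) ⊓ (⊤ : Submodule ℤ (Gen15 k → ℤ))) :=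
    ⟨_, D15_top k c, trivial⟩
  let h3 : ↥(LinearMap.ker (D15 k c) ⊓ (⊤ : Submodule ℤ (Gen15 k → ℤ))) :=
    ⟨_, D15_d1 k c, trivial⟩
  have e1 : homologySurvivors k c (homologyMk (D15 k c) ⊤ h1) = Pi.single 0 1 :=
    survivors_a0 k
  have e2 : homologySurvivors k c (homologyMk (D15 k c) ⊤ h2) = Pi.single 1 1 :=
    survivors_top hk
  have e3 : homologySurvivors k c (homologyMk (D15 k c) ⊤ h3) = Pi.single 2 1 :=
    survivors_d1 hk
  have key (v : Fin 3 → ℤ) : homologySurvivors k c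
      (v 0 • homologyMk (D15 k c) ⊤ h1 + v 1 • homologyMk (D15 k c) ⊤ h2 +
        v 2 • homologyMk (D15 k c) ⊤ h3) = v := by
    rw [map_add, map_add, map_smul, map_smul, map_smul, e1, e2, e3]
    ext i
    fin_cases i <;> simp
  have inj := homologySurvivors_injective k c
  refine ⟨h1, h2, h3, rfl, rfl, rfl, ?_,
    ⟨LinearEquiv.ofBijective (homologySurvivors k c) ⟨inj, fun v => ⟨_, key v⟩⟩⟩⟩
  refine eq_top_iff.2 fun a _ => Submodule.mem_span_triple.2 ⟨_, _, _, inj (key _)⟩
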